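/- Let λ(x,y) = (x - qy)/(x - y) for a parameter q. Let F_α^{(n)} be the space of symmetric polynomials in α variables having degree less than n in each variable. Then for f ∈ F_α^{(n)} and g ∈ F_β^{(n)}, the shuffle product f*g (defined with weight factor λ) lies in F_{α+β}^{(n)}; in particular each apparent pole along u_i = u_j cancels and f*g is a polynomial. -/

import Mathlib

open Finset MvPolynomial

/-- The value of the shuffle product of `f` and `g` with weight
`λ(x,y) = (x - qy)/(x - y)`, at a point `u` with pairwise distinct coordinates. -/
noncomputable def shuffleVal (q : ℂ) {α β : ℕ}
    (f : MvPolynomial (Fin α) ℂ) (g : MvPolynomial (Fin β) ℂ)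
    (u : Fin (α + β) → ℂ) : ℂ :=
  (1 / ((α.factorial : ℂ) * (β.factorial : ℂ))) *
    ∑ σ : Equiv.Perm (Fin (α + β)),
      (eval (fun i => u (σ (Fin.castAdd β i))) f) *
        (eval (fun j => u (σ (Fin.natAdd α j))) g) *
          ∏ i : Fin α, ∏ j : Fin β,
            (u (σ (Fin.castAdd β i)) - q * u (σ (Fin.natAdd α j))) /
              (u (σ (Fin.castAdd β i)) - u (σ (Fin.natAdd α j)))

namespace ShuffleAux

/-- Complex-valued sign of a permutation. -/
noncomputable def sg {m : ℕ} (σ : Equiv.Perm (Fin m)) : ℂ := ((Equiv.Perm.sign σ : ℤ) : ℂ)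

lemma sg_mul {m : ℕ} (σ τ : Equiv.Perm (Fin m)) : sg (σ * τ) = sg σ * sg τ := by
  simp [sg]

lemma sg_sq {m : ℕ} (σ : Equiv.Perm (Fin m)) : sg σ * sg σ = 1 := by
  rcases Int.units_eq_one_or (Equiv.Perm.sign σ) with h | h <;> simp [sg, h]

lemma sg_ne {m : ℕ} (σ : Equiv.Perm (Fin m)) : sg σ ≠ 0 := by
  intro h
  have := sg_sq σ
  simp [h] at this

/-- Antisymmetric polynomials. -/
def Anti {m : ℕ} (p : MvPolynomial (Fin m) ℂ) : Prop :=
  ∀ σ : Equiv.Perm (Fin m), rename σ p = C (sg σ) * p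

/-- Substitution `X b ↦ X a`. -/
noncomputable def sub {m : ℕ} (a b : Fin m) :
    MvPolynomial (Fin m) ℂ →ₐ[ℂ] MvPolynomial (Fin m) ℂ :=
  aeval (fun k => if k = b then X a else X k)

lemma dvd_sub {m : ℕ} (a b : Fin m) (p : MvPolynomial (Fin m) ℂ) :
    (X b - X a : MvPolynomial (Fin m) ℂ) ∣ p - sub a b p := by
  rw [← Ideal.mem_span_singleton, ← Ideal.Quotient.eq]
  have : (Ideal.Quotient.mkₐ ℂ (Ideal.span {(X b - X a : MvPolynomial (Fin m) ℂ)})) =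
    (Ideal.Quotient.mkₐ ℂ (Ideal.span {(X b - X a : MvPolynomial (Fin m) ℂ)})).comp (sub a b) := by
    ext k
    simp only [sub, AlgHom.comp_apply, aeval_X]
    split_ifs with h
    · subst h
      simp only [Ideal.Quotient.mkₐ_eq_mk]
      rw [Ideal.Quotient.eq, Ideal.mem_span_singleton]
    · rfl
  exact DFunLike.congr_fun this p

lemma dvd_iff {m : ℕ} {a b : Fin m} (hab : a ≠ b) (p : MvPolynomial (Fin m) ℂ) :
    (X b - X a : MvPolynomial (Fin m) ℂ) ∣ p ↔ sub a b p = 0 := by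
  constructor
  · rintro ⟨r, rfl⟩
    simp [sub, hab]
  · intro h
    simpa [h] using dvd_sub a b p

lemma X_sub_ne {m : ℕ} {a b : Fin m} (hab : a ≠ b) :
    (X b - X a : MvPolynomial (Fin m) ℂ) ≠ 0 := by
  rw [sub_ne_zero]
  intro h
  exact hab (X_injective h).symm

lemma prime_sub {m : ℕ} {a b : Fin m} (hab : a ≠ b) :
    Prime (X b - X a : MvPolynomial (Fin m) ℂ) := by
  refine ⟨X_sub_ne hab, ?_, ?_⟩
  · intro h
    have := (dvd_iff hab 1).1 h.dvd
    simp at this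
  · intro p r h
    simp only [dvd_iff hab] at h ⊢
    simpa using h

lemma anti_dvd {m : ℕ} {a b : Fin m} (hab : a ≠ b) {p : MvPolynomial (Fin m) ℂ} (hp : Anti p) :
    (X b - X a : MvPolynomial (Fin m) ℂ) ∣ p := by
  rw [dvd_iff hab]
  have h := congrArg (sub a b) (hp (Equiv.swap a b))
  have h2 : sub a b (rename (Equiv.swap a b) p) = sub a b p := by
    rw [sub, aeval_rename]
    congr 2
    funext k
    simp only [Function.comp]
    by_cases h1 : k = a
    · subst h1; simp [hab]
    · by_cases h2 : k = b
      · subst h2; simp [hab]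
      · rw [Equiv.swap_apply_of_ne_of_ne h1 h2]
  rw [h2] at h
  have h3 : sg (Equiv.swap a b) = -1 := by simp [sg, Equiv.Perm.sign_swap hab]
  rw [h3] at h
  simp only [map_neg, map_one, neg_mul, one_mul] at h
  exact self_eq_neg.1 h

lemma relprime {m : ℕ} {a b c d : Fin m} (hab : a < b) (hcd : c < d) (hne : (a, b) ≠ (c, d)) :
    IsRelPrime (X b - X a : MvPolynomial (Fin m) ℂ) (X d - X c) := by
  rw [(prime_sub hab.ne).irreducible.isRelPrime_iff_not_dvd, dvd_iff hab.ne]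
  simp only [sub, map_sub, aeval_X]
  intro h
  rw [sub_eq_zero] at h
  apply hne
  split_ifs at h <;> have h' := X_injective h <;> simp only [Prod.mk.injEq] <;> omega

lemma prod_dvd {m : ℕ} {ι : Type*} (s : Finset ι) (a b : ι → Fin m)
    (hab : ∀ t ∈ s, a t < b t)
    (hinj : ∀ t ∈ s, ∀ t' ∈ s, a t = a t' → b t = b t' → t = t')
    {p : MvPolynomial (Fin m) ℂ} (hp : Anti p) :
    (∏ t ∈ s, (X (b t) - X (a t) : MvPolynomial (Fin m) ℂ)) ∣ p := by
  apply Finset.prod_dvd_of_isRelPrime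
  · intro t ht t' ht' hne
    apply relprime (hab t ht) (hab t' ht')
    intro h
    simp only [Prod.mk.injEq] at h
    exact hne (hinj t ht t' ht' h.1 h.2)
  · intro t ht
    exact anti_dvd (hab t ht).ne hp

/-- The Vandermonde polynomial. -/
noncomputable def V (m : ℕ) : MvPolynomial (Fin m) ℂ :=
  (Matrix.vandermonde (X : Fin m → MvPolynomial (Fin m) ℂ)).det

lemma V_anti (m : ℕ) : Anti (V m) := by
  intro σ
  have := Matrix.det_permute σ (Matrix.vandermonde (X : Fin m → MvPolynomial (Fin m) ℂ))
  unfold V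
  rw [AlgHom.map_det]
  have e : C (sg σ) = (((Equiv.Perm.sign σ : ℤ)) : MvPolynomial (Fin m) ℂ) := by simp [sg]
  rw [e, ← this]
  congr 1
  ext i j : 2
  simp [Matrix.vandermonde]

lemma V_dvd {m : ℕ} {p : MvPolynomial (Fin m) ℂ} (hp : Anti p) : V m ∣ p := by
  unfold V
  rw [Matrix.det_vandermonde, Finset.prod_sigma']
  refine prod_dvd (Finset.univ.sigma fun i : Fin m => Finset.Ioi i)
    (fun t : (_ : Fin m) × Fin m => t.1) (fun t => t.2) ?_ ?_ hp
  · intro t ht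
    simpa using ht
  · rintro ⟨i, j⟩ _ ⟨i', j'⟩ _ h1 h2
    simp only at h1 h2
    subst h1 h2
    rfl

lemma V_ne (m : ℕ) : V m ≠ 0 :=
  Matrix.det_vandermonde_ne_zero_iff.2 X_injective

lemma eval_V_ne {m : ℕ} {u : Fin m → ℂ} (hu : Function.Injective u) : eval u (V m) ≠ 0 := by
  unfold V
  rw [RingHom.map_det]
  have : (eval u).mapMatrix (Matrix.vandermonde (X : Fin m → MvPolynomial (Fin m) ℂ))
      = Matrix.vandermonde u := by
    ext i j
    simp [Matrix.vandermonde]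
  rw [this]
  exact Matrix.det_vandermonde_ne_zero_iff.2 hu

/-- Antisymmetrization. -/
noncomputable def alt {m : ℕ} (B : MvPolynomial (Fin m) ℂ) : MvPolynomial (Fin m) ℂ :=
  ∑ σ : Equiv.Perm (Fin m), C (sg σ) * rename σ B

lemma alt_anti {m : ℕ} (B : MvPolynomial (Fin m) ℂ) : Anti (alt B) := by
  intro τ
  unfold alt
  rw [map_sum, Finset.mul_sum]
  refine Fintype.sum_equiv (Equiv.mulLeft τ) _ _ fun σ => ?_
  simp only [map_mul, rename_C, rename_rename, Equiv.coe_mulLeft, sg_mul]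
  rw [← mul_assoc, ← mul_assoc, ← map_mul, ← map_mul, sg_sq, one_mul]
  rfl

lemma degV {m : ℕ} (σ : Equiv.Perm (Fin m)) (k : Fin m) :
    degreeOf (σ k) (V m) = degreeOf k (V m) := by
  rw [← degreeOf_rename_of_injective σ.injective k (p := V m), V_anti _ σ,
    degreeOf_C_mul _ _ (mem_nonZeroDivisors_of_ne_zero (sg_ne σ))]

lemma deg_alt {m : ℕ} (B : MvPolynomial (Fin m) ℂ) (n : ℕ)
    (hB : ∀ k, degreeOf k B < n + degreeOf k (V m)) (k : Fin m) :
    degreeOf k (alt B) < n + degreeOf k (V m) := by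
  unfold alt
  refine (degreeOf_sum_le _ _ _).trans_lt ?_
  rw [Finset.sup_lt_iff (by simpa using (Nat.zero_le _).trans_lt (hB k))]
  intro σ _
  refine (degreeOf_C_mul_le _ _ _).trans_lt ?_
  have h := degreeOf_rename_of_injective σ.injective (σ.symm k) (p := B)
  rw [Equiv.apply_symm_apply] at h
  rw [h]
  have h2 := degV σ (σ.symm k)
  rw [Equiv.apply_symm_apply] at h2
  rw [h2]
  exact hB _

lemma degfac {m : ℕ} (q : ℂ) {a b : Fin m} (hab : a ≠ b) (k : Fin m) :
    degreeOf k (C q * X b - X a : MvPolynomial (Fin m) ℂ) ≤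
      degreeOf k (X b - X a : MvPolynomial (Fin m) ℂ) := by
  by_cases hk : k = a ∨ k = b
  · have h1 : degreeOf k (C q * X b - X a : MvPolynomial (Fin m) ℂ) ≤ 1 := by
      refine (degreeOf_sub_le _ _ _).trans (max_le ((degreeOf_C_mul_le _ _ _).trans ?_) ?_) <;>
      · rw [degreeOf_X]; split_ifs <;> simp
    refine h1.trans ?_
    have := monomial_le_degreeOf k (f := (X b - X a : MvPolynomial (Fin m) ℂ))
      (m := Finsupp.single k 1) ?_
    · simpa using this
    · rw [mem_support_iff, coeff_sub, coeff_X, coeff_X]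
      rcases hk with rfl | rfl
      · simp [Finsupp.single_left_inj, hab.symm]
      · simp [Finsupp.single_left_inj, hab]
  · push Not at hk
    have : degreeOf k (C q * X b - X a : MvPolynomial (Fin m) ℂ) ≤ 0 := by
      refine (degreeOf_sub_le _ _ _).trans (max_le ((degreeOf_C_mul_le _ _ _).trans ?_) ?_)
      · rw [degreeOf_X_of_ne hk.2]
      · rw [degreeOf_X_of_ne hk.1]
    omega

lemma deg_rename_out {σ τ : Type*} (f : σ → τ) (p : MvPolynomial σ ℂ) (k : τ)
    (hk : ∀ i, f i ≠ k) : degreeOf k (rename f p) = 0 := by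
  classical
  rw [← Nat.le_zero, degreeOf_def]
  refine Nat.le_zero.2 (Multiset.count_eq_zero.2 fun h => ?_)
  rw [← Multiset.mem_toFinset] at h
  have h2 := vars_rename f p h
  rw [Finset.mem_image] at h2
  obtain ⟨i, _, hi⟩ := h2
  exact hk i hi

end ShuffleAux

open ShuffleAux

/-- If `f`, `g` are symmetric polynomials of degree `< n` in each variable, then
their shuffle product with weight `(x-qy)/(x-y)` is again (given by) a symmetric
polynomial of degree `< n` in each variable: all poles along the diagonals cancel. -/
theorem shuffleVal_polynomial (q : ℂ) (n : ℕ) {α β : ℕ}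
    (f : MvPolynomial (Fin α) ℂ) (g : MvPolynomial (Fin β) ℂ)
    (hfsym : f.IsSymmetric) (hgsym : g.IsSymmetric)
    (hfdeg : ∀ i, f.degreeOf i < n) (hgdeg : ∀ j, g.degreeOf j < n) :
    ∃ P : MvPolynomial (Fin (α + β)) ℂ,
      P.IsSymmetric ∧ (∀ i, P.degreeOf i < n) ∧
        ∀ u : Fin (α + β) → ℂ, Function.Injective u →
          eval u P = shuffleVal q f g u := by
  set cross : MvPolynomial (Fin (α + β)) ℂ :=
    ∏ t : Fin α × Fin β, (X (Fin.natAdd α t.2) - X (Fin.castAdd β t.1)) with hcross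
  set crossq : MvPolynomial (Fin (α + β)) ℂ :=
    ∏ t : Fin α × Fin β, (C q * X (Fin.natAdd α t.2) - X (Fin.castAdd β t.1)) with hcrossq
  have hlt : ∀ (i : Fin α) (j : Fin β), Fin.castAdd β i < Fin.natAdd α j := by
    intro i j
    simp only [Fin.lt_def, Fin.val_castAdd, Fin.val_natAdd]
    omega
  obtain ⟨W, hW⟩ : cross ∣ V (α + β) := by
    apply prod_dvd _ (fun t : Fin α × Fin β => Fin.castAdd β t.1)
      (fun t => Fin.natAdd α t.2) _ _ (V_anti _)
    · intro t _
      exact hlt _ _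
    · rintro ⟨i, j⟩ _ ⟨i', j'⟩ _ h1 h2
      simp at h1 h2
      simp [h1, h2]
  have hVne := V_ne (α + β)
  have hcne : cross ≠ 0 := fun h => hVne (by rw [hW, h, zero_mul])
  have hWne : W ≠ 0 := fun h => hVne (by rw [hW, h, mul_zero])
  set B := rename (Fin.castAdd β) f * rename (Fin.natAdd α) g * crossq * W with hB
  have hdegfg : ∀ k, degreeOf k (rename (Fin.castAdd β) f) +
      degreeOf k (rename (Fin.natAdd α) g) < n := by
    intro k
    refine Fin.addCases (fun i => ?_) (fun j => ?_) k
    · rw [degreeOf_rename_of_injective (Fin.castAdd_injective α β),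
        deg_rename_out _ g _ (fun j => (hlt i j).ne'), add_zero]
      exact hfdeg i
    · rw [degreeOf_rename_of_injective (Fin.natAdd_injective β α),
        deg_rename_out _ f _ (fun i => (hlt i j).ne), zero_add]
      exact hgdeg j
  have hdegB : ∀ k, degreeOf k B < n + degreeOf k (V (α + β)) := by
    intro k
    have h1 : degreeOf k crossq ≤ degreeOf k cross := by
      rw [hcross, degreeOf_prod_eq _ _ (fun t _ => X_sub_ne (hlt t.1 t.2).ne)]
      refine (degreeOf_prod_le _ _ _).trans (Finset.sum_le_sum fun t _ => ?_)
      exact degfac q (hlt t.1 t.2).ne k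
    rw [hW, degreeOf_mul_eq hcne hWne, hB]
    have h2 := degreeOf_mul_le k (rename (Fin.castAdd β) f * rename (Fin.natAdd α) g * crossq) W
    have h3 := degreeOf_mul_le k (rename (Fin.castAdd β) f * rename (Fin.natAdd α) g) crossq
    have h4 := degreeOf_mul_le k (rename (Fin.castAdd β) f) (rename (Fin.natAdd α) g)
    have h5 := hdegfg k
    omega
  obtain ⟨P, hP⟩ := V_dvd (alt_anti B)
  refine ⟨C (1 / ((α.factorial : ℂ) * (β.factorial : ℂ))) * P, ?_, ?_, ?_⟩
  · apply MvPolynomial.IsSymmetric.mul (MvPolynomial.IsSymmetric.C _)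
    intro σ
    have h := alt_anti B σ
    rw [hP, map_mul, V_anti _ σ, mul_assoc] at h
    have hC : (C (sg σ) : MvPolynomial (Fin (α + β)) ℂ) ≠ 0 := by
      simpa using sg_ne σ
    exact mul_left_cancel₀ hVne (mul_left_cancel₀ hC h)
  · intro k
    refine (degreeOf_C_mul_le _ _ _).trans_lt ?_
    by_cases hP0 : P = 0
    · rw [hP0, degreeOf_zero]
      exact (Nat.zero_le _).trans_lt (hdegfg k)
    · have h := deg_alt B n hdegB k
      rw [hP, degreeOf_mul_eq hVne hP0] at h
      omega
  · intro u hu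
    rw [map_mul, eval_C, shuffleVal]
    congr 1
    apply mul_left_cancel₀ (eval_V_ne hu)
    rw [← map_mul, ← hP, alt, map_sum, Finset.mul_sum]
    refine Finset.sum_congr rfl fun σ _ => ?_
    have hV : eval (u ∘ σ) (V (α + β)) = sg σ * eval u (V (α + β)) := by
      rw [← eval_rename, V_anti _ σ, map_mul, eval_C]
    have hce : eval (u ∘ σ) cross ≠ 0 := by
      intro h
      apply eval_V_ne (hu.comp σ.injective)
      rw [hW, map_mul, h, zero_mul]
    have hquot : (∏ i : Fin α, ∏ j : Fin β,
            (u (σ (Fin.castAdd β i)) - q * u (σ (Fin.natAdd α j))) /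
              (u (σ (Fin.castAdd β i)) - u (σ (Fin.natAdd α j)))) =
        eval (u ∘ σ) crossq / eval (u ∘ σ) cross := by
      rw [hcross, hcrossq, map_prod, map_prod, ← Finset.prod_div_distrib,
        ← Finset.univ_product_univ, Finset.prod_product]
      refine Finset.prod_congr rfl fun i _ => Finset.prod_congr rfl fun j _ => ?_
      simp only [map_sub, map_mul, eval_C, eval_X, Function.comp]
      rw [← neg_div_neg_eq, neg_sub, neg_sub]
    have hVW : sg σ * eval (u ∘ σ) (V (α + β)) = eval u (V (α + β)) := by
      rw [hV, ← mul_assoc, sg_sq, one_mul]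
    rw [hquot, ← hVW, hW, hB]
    simp only [map_mul, eval_C, eval_rename]
    have e1 : (u ∘ σ) ∘ Fin.castAdd β = fun i => u (σ (Fin.castAdd β i)) := rfl
    have e2 : (u ∘ σ) ∘ Fin.natAdd α = fun i => u (σ (Fin.natAdd α i)) := rfl
    rw [e1, e2]
    field_simp
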